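/- Let k be a field, n a natural number, and S = k[x_1,...,x_n] the polynomial ring in n variables over k. Let M be an ideal of S generated by finitely many squarefree monomials m_1,...,m_q (monomials in which every variable occurs with exponent at most 1), and suppose that deg(m_i) > d for every i = 1,...,q, for some natural number d ≥ 0. Then the projective dimension of the S-module S/M is at most n − d. -/

import Mathlib

open CategoryTheory MvPolynomial

section PdRes
open Limits
open scoped ZeroObject
universe v u
variable {C : Type u} [Category.{v} C] [Abelian C]

def PdRes (Z : C) (n : ℕ) : Prop :=
  ∃ (K : ChainComplex C ℕ) (p : K.X 0 ⟶ Z) (w : K.d 1 0 ≫ p = 0),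
    (∀ i, Projective (K.X i)) ∧ Epi p ∧ (ShortComplex.mk (K.d 1 0) p w).Exact ∧
    (∀ i, (ShortComplex.mk _ _ (K.d_comp_d (i + 2) (i + 1) i)).Exact) ∧
    ∀ i, n ≤ i → IsZero (K.X i)

lemma PdRes.zero {Z : C} (h : IsZero Z) : PdRes Z 0 := by
  have h0 : ∀ i, IsZero ((0 : ChainComplex C ℕ).X i) := fun i =>
    ((HomologicalComplex.eval C (ComplexShape.down ℕ) i).map_isZero (isZero_zero _))
  refine ⟨0, 0, by simp, fun i => (h0 i).projective, ?_, ?_, ?_, fun i _ => h0 i⟩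
  · exact ⟨fun f g _ => h.eq_of_src _ _⟩
  · exact ShortComplex.exact_of_isZero_X₂ _ (h0 0)
  · intro i; exact ShortComplex.exact_of_isZero_X₂ _ (h0 _)

lemma PdRes.step {S : ShortComplex C} (hS : S.ShortExact) [Projective S.X₂] {n : ℕ}
    (h : PdRes S.X₁ n) : PdRes S.X₃ (n + 1) := by
  obtain ⟨K, p, w, hP, hp, h0, hex, hz⟩ := h
  have := hS.mono_f
  have := hS.epi_g
  have w' : K.d 1 0 ≫ (p ≫ S.f) = 0 := by rw [← Category.assoc, w, zero_comp]
  refine ⟨K.augment (p ≫ S.f) w', S.g, ?_, ?_, hS.epi_g, ?_, ?_, ?_⟩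
  · change (p ≫ S.f) ≫ S.g = 0
    simp
  · rintro (_ | i)
    · assumption
    · exact hP i
  · let α : ShortComplex.mk (p ≫ S.f) S.g (by simp) ⟶ S :=
      { τ₁ := p, τ₂ := 𝟙 _, τ₃ := 𝟙 _ }
    have : Epi α.τ₁ := hp
    have : IsIso α.τ₂ := inferInstanceAs (IsIso (𝟙 _))
    have : Mono α.τ₃ := inferInstanceAs (Mono (𝟙 _))
    exact (ShortComplex.exact_iff_of_epi_of_isIso_of_mono α).2 hS.exact
  · rintro (_ | i)
    · let α : ShortComplex.mk (K.d 1 0) p w ⟶ ShortComplex.mk (K.d 1 0) (p ≫ S.f) w' :=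
        { τ₁ := 𝟙 _, τ₂ := 𝟙 _, τ₃ := S.f }
      have : Epi α.τ₁ := inferInstanceAs (Epi (𝟙 _))
      have : IsIso α.τ₂ := inferInstanceAs (IsIso (𝟙 _))
      have : Mono α.τ₃ := inferInstanceAs (Mono S.f)
      exact (ShortComplex.exact_iff_of_epi_of_isIso_of_mono α).1 h0
    · exact hex i
  · rintro (_ | i) hi
    · omega
    · exact hz i (by omega)

lemma PdRes.of_lt [EnoughProjectives C] (n : ℕ) : ∀ (Z : C), HasProjectiveDimensionLT Z n →
    PdRes Z n := by
  induction n with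
  | zero => intro Z h; exact PdRes.zero (isZero_of_hasProjectiveDimensionLT_zero Z)
  | succ n ih =>
    intro Z h
    obtain _ | n := n
    · have : Projective Z := projective_iff_hasProjectiveDimensionLT_one.2 h
      have hS : (ShortComplex.mk (0 : 0 ⟶ Z) (𝟙 Z) (by simp)).ShortExact :=
        { exact := (ShortComplex.exact_iff_mono _ rfl).2 (inferInstanceAs (Mono (𝟙 Z)))
          mono_f := ⟨fun _ _ _ => (isZero_zero C).eq_of_tgt _ _⟩
          epi_g := inferInstanceAs (Epi (𝟙 Z)) }
      have : Projective (ShortComplex.mk (0 : 0 ⟶ Z) (𝟙 Z) (by simp)).X₂ := ‹Projective Z›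
      exact PdRes.step hS (PdRes.zero (isZero_zero C))
    · let S := ShortComplex.mk (kernel.ι (Projective.π Z)) (Projective.π Z) (by simp)
      have hS : S.ShortExact :=
        { exact := ShortComplex.exact_of_f_is_kernel _ (kernelIsKernel _)
          mono_f := inferInstanceAs (Mono (kernel.ι _))
          epi_g := inferInstanceAs (Epi (Projective.π Z)) }
      have hpr : Projective S.X₂ := inferInstanceAs (Projective (Projective.over Z))
      have h2 : HasProjectiveDimensionLT S.X₂ (n + 1) :=
        hasProjectiveDimensionLT_of_ge _ 1 _ (by omega)
      exact PdRes.step hS (ih _ (hS.hasProjectiveDimensionLT_X₁ _ h2 h))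

lemma PdRes.res {Z : C} {n : ℕ} (h : PdRes Z n) :
    ∃ P : ProjectiveResolution Z, ∀ i, n ≤ i → IsZero (P.complex.X i) := by
  obtain ⟨K, p, w, hP, hp, h0, hex, hz⟩ := h
  refine ⟨⟨K, hP, (ChainComplex.toSingle₀Equiv _ _).symm ⟨p, w⟩, ⟨fun n => ?_⟩⟩, hz⟩
  obtain _ | n := n
  · rw [ChainComplex.quasiIsoAt₀_iff, ShortComplex.quasiIso_iff_of_zeros']
    · refine (ShortComplex.exact_and_epi_g_iff_of_iso ?_).2 ⟨h0, hp⟩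
      exact ShortComplex.isoMk (Iso.refl _) (Iso.refl _) (Iso.refl _)
          ((Category.id_comp _).trans (Category.comp_id _).symm)
          ((Category.id_comp p).trans ((Category.comp_id p).symm.trans
            (congrArg (fun q => q ≫ 𝟙 Z) (ChainComplex.toSingle₀Equiv_symm_apply_f_zero p w).symm)))
    · exact K.shape _ _ (by simp)
    · rfl
    · exact ((ChainComplex.single₀ C).obj Z).shape _ _ (by simp)
  · rw [quasiIsoAt_iff_exactAt']
    · rw [HomologicalComplex.exactAt_iff' _ (n + 1 + 1) (n + 1) n (by simp) (by simp)]
      exact hex _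
    · apply ChainComplex.exactAt_succ_single_obj
end PdRes

section Alg
universe u
lemma pd_ses {R : Type u} [CommRing R] (J K : Ideal R) (a : R)
    (h : ∀ f, a * f ∈ K ↔ f ∈ J) :
    ∃ S : ShortComplex (ModuleCat.{u} R), S.ShortExact ∧ S.X₁ = ModuleCat.of R (R ⧸ J) ∧
      S.X₂ = ModuleCat.of R (R ⧸ K) ∧ S.X₃ = ModuleCat.of R (R ⧸ (K ⊔ Ideal.span {a})) := by
  let f : (R ⧸ J) →ₗ[R] (R ⧸ K) := Submodule.mapQ J K (LinearMap.mulLeft R a)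
    (fun x hx => (h x).2 hx)
  let g : (R ⧸ K) →ₗ[R] (R ⧸ (K ⊔ Ideal.span {a})) := Submodule.factor le_sup_left
  have hfg : Function.Exact f g := by
    intro y
    obtain ⟨y, rfl⟩ := Submodule.Quotient.mk_surjective K y
    have : g (Submodule.Quotient.mk y) = Submodule.Quotient.mk y := rfl
    rw [this, Submodule.Quotient.mk_eq_zero]
    constructor
    · intro hy
      obtain ⟨u, hu, v, hv, rfl⟩ := Submodule.mem_sup.1 hy
      obtain ⟨c, rfl⟩ := Ideal.mem_span_singleton'.1 hv
      refine ⟨Submodule.Quotient.mk c, ?_⟩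
      change Submodule.Quotient.mk (a * c) = _
      rw [Submodule.Quotient.eq]
      have : a * c - (u + c * a) = -u := by ring
      rw [this]; exact neg_mem hu
    · rintro ⟨x, hx⟩
      obtain ⟨x, rfl⟩ := Submodule.Quotient.mk_surjective J x
      change Submodule.Quotient.mk (a * x) = _ at hx
      rw [Submodule.Quotient.eq] at hx
      have : y = a * x - (a * x - y) := by ring
      rw [this]
      exact sub_mem (Ideal.mul_mem_right _ _ (Ideal.mem_sup_right (Ideal.mem_span_singleton_self a)))
        (Ideal.mem_sup_left hx)
  have hf : Function.Injective f := by
    rw [← LinearMap.ker_eq_bot, LinearMap.ker_eq_bot']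
    intro x hx
    obtain ⟨x, rfl⟩ := Submodule.Quotient.mk_surjective J x
    change Submodule.Quotient.mk (a * x) = _ at hx
    rw [Submodule.Quotient.mk_eq_zero] at hx ⊢
    exact (h x).1 hx
  have hg : Function.Surjective g := by
    intro y
    obtain ⟨y, rfl⟩ := Submodule.Quotient.mk_surjective _ y
    exact ⟨Submodule.Quotient.mk y, rfl⟩
  refine ⟨ShortComplex.mk (ModuleCat.ofHom f) (ModuleCat.ofHom g) ?_, ?_, rfl, rfl, rfl⟩
  · refine ModuleCat.hom_ext (LinearMap.ext fun x => (hfg _).2 ⟨x, rfl⟩)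
  · exact { exact := (ShortComplex.ShortExact.moduleCat_exact_iff_function_exact _).2 hfg
            mono_f := (ModuleCat.mono_iff_injective _).2 hf
            epi_g := (ModuleCat.epi_iff_surjective _).2 hg }

abbrev PdQ {R : Type u} [CommRing R] (I : Ideal R) (n : ℕ) : Prop :=
  HasProjectiveDimensionLT (ModuleCat.of R (R ⧸ I)) n

lemma pdQ_mid {R : Type u} [CommRing R] (J K : Ideal R) (a : R)
    (h : ∀ f, a * f ∈ K ↔ f ∈ J) (n : ℕ) (h1 : PdQ J n) (h3 : PdQ (K ⊔ Ideal.span {a}) n) :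
    PdQ K n := by
  obtain ⟨S, hS, e1, e2, e3⟩ := pd_ses J K a h
  unfold PdQ at *
  rw [← e1] at h1; rw [← e3] at h3; rw [← e2]
  exact hS.hasProjectiveDimensionLT_X₂ n h1 h3

lemma pdQ_quot {R : Type u} [CommRing R] (K : Ideal R) (a : R)
    (h : ∀ f, a * f ∈ K ↔ f ∈ K) (n : ℕ) (h1 : PdQ K n) :
    PdQ (K ⊔ Ideal.span {a}) (n + 1) := by
  obtain ⟨S, hS, e1, e2, e3⟩ := pd_ses K K a h
  unfold PdQ at *
  have h2 := hasProjectiveDimensionLT_of_ge (ModuleCat.of R (R ⧸ K)) n (n + 1) (by omega)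
  rw [← e1] at h1; rw [← e2] at h2; rw [← e3]
  exact hS.hasProjectiveDimensionLT_X₃ n h1 h2

lemma pdQ_bot {R : Type u} [CommRing R] (n : ℕ) : PdQ (⊥ : Ideal R) (n + 1) := by
  have : Module.Projective R (R ⧸ (⊥ : Ideal R)) :=
    Module.Projective.of_equiv (Submodule.quotEquivOfEqBot (⊥ : Submodule R R) rfl).symm
  have : Projective (ModuleCat.of R (R ⧸ (⊥ : Ideal R))) :=
    (IsProjective.iff_projective _).1 this
  exact hasProjectiveDimensionLT_of_ge _ 1 _ (by omega)

lemma pdQ_top {R : Type u} [CommRing R] (n : ℕ) : PdQ (⊤ : Ideal R) n := by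
  have : Subsingleton (R ⧸ (⊤ : Ideal R)) := Ideal.Quotient.subsingleton_iff.2 rfl
  have := (ModuleCat.isZero_of_subsingleton (ModuleCat.of R (R ⧸ (⊤ : Ideal R)))
    ).hasProjectiveDimensionLT_zero
  exact hasProjectiveDimensionLT_of_ge _ 0 _ (by omega)

noncomputable abbrev mI {n : ℕ} (k : Type u) [Field k] (A : Set (Fin n →₀ ℕ)) :
    Ideal (MvPolynomial (Fin n) k) :=
  Ideal.span ((fun s => monomial s (1 : k)) '' A)

lemma mI_colon {n : ℕ} (k : Type u) [Field k] (A : Set (Fin n →₀ ℕ))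
    (hA : ∀ s ∈ A, ∀ j, s j ≤ 1) (x : Fin n) (f : MvPolynomial (Fin n) k) :
    X x * f ∈ mI k A ↔ f ∈ mI k (Finsupp.erase x '' A) := by
  rw [mem_ideal_span_monomial_image, mem_ideal_span_monomial_image, support_X_mul]
  have key : ∀ s ∈ A, ∀ m : Fin n →₀ ℕ, s ≤ Finsupp.single x 1 + m ↔ Finsupp.erase x s ≤ m := by
    intro s hs m
    simp only [Finsupp.le_def]
    refine forall_congr' fun j => ?_
    have := hA s hs j
    by_cases hj : j = x
    · subst hj; simp; omega
    · simp [Finsupp.erase_ne hj, Ne.symm hj]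
  simp only [Finset.mem_map, addLeftEmbedding_apply, forall_exists_index, and_imp,
    forall_apply_eq_imp_iff₂, Set.exists_mem_image]
  refine forall₂_congr fun m hm => ⟨?_, ?_⟩
  · rintro ⟨s, hs, h⟩; exact ⟨s, hs, (key s hs m).1 h⟩
  · rintro ⟨s, hs, h⟩; exact ⟨s, hs, (key s hs m).2 h⟩

lemma mI_sup {n : ℕ} (k : Type u) [Field k] (A : Set (Fin n →₀ ℕ)) (x : Fin n) :
    mI k A ⊔ Ideal.span {X x} = mI k {s ∈ A | s x = 0} ⊔ Ideal.span {X x} := by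
  apply le_antisymm
  · refine sup_le (Ideal.span_le.2 ?_) le_sup_right
    rintro _ ⟨s, hs, rfl⟩
    by_cases h : s x = 0
    · exact Ideal.mem_sup_left (Ideal.subset_span ⟨s, ⟨hs, h⟩, rfl⟩)
    · refine Ideal.mem_sup_right (Ideal.mem_span_singleton.2 ?_)
      rw [X, monomial_dvd_monomial]
      exact ⟨Or.inr (by simpa [Nat.one_le_iff_ne_zero] using h), one_dvd _⟩
  · exact sup_le_sup_right (Ideal.span_mono (Set.image_mono (fun s hs => hs.1))) _

lemma pd_main {n : ℕ} (k : Type u) [Field k] (V : Finset (Fin n)) :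
    ∀ (e : ℕ) (A : Set (Fin n →₀ ℕ)), (∀ s ∈ A, ∀ j, s j ≤ 1) → (∀ s ∈ A, s.support ⊆ V) →
      (∀ s ∈ A, V.card < s.support.card + e) → PdQ (mI k A) (e + 1) := by
  induction V using Finset.induction_on with
  | empty =>
    intro e A h1 h2 h3
    rcases A.eq_empty_or_nonempty with rfl | ⟨s, hs⟩
    · have : mI k (∅ : Set (Fin n →₀ ℕ)) = ⊥ := by simp [mI]
      rw [this]; exact pdQ_bot e
    · have hs0 : s = 0 := by simpa using h2 s hs
      have : mI k A = ⊤ := by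
        rw [Ideal.eq_top_iff_one]
        exact Ideal.subset_span ⟨s, hs, by simp [hs0]⟩
      rw [this]; exact pdQ_top _
  | insert x V hx ih =>
    intro e A h1 h2 h3
    obtain _ | e := e
    · have : A = ∅ := by
        rw [Set.eq_empty_iff_forall_notMem]
        intro s hs
        have := Finset.card_le_card (h2 s hs)
        have := h3 s hs
        omega
      have : mI k A = ⊥ := by simp [mI, this]
      rw [this]; exact pdQ_bot 0
    rw [Finset.card_insert_of_notMem hx] at h3
    refine pdQ_mid _ _ (X x) (mI_colon k A h1 x) _ ?_ ?_
    · apply ih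
      · rintro _ ⟨s, hs, rfl⟩ j
        by_cases hj : j = x
        · subst hj; simp
        · rw [Finsupp.erase_ne hj]; exact h1 s hs j
      · rintro _ ⟨s, hs, rfl⟩
        rw [Finsupp.support_erase]
        intro j hj
        have := h2 s hs (Finset.mem_of_mem_erase hj)
        exact (Finset.mem_insert.1 this).resolve_left (Finset.ne_of_mem_erase hj)
      · rintro _ ⟨s, hs, rfl⟩
        rw [Finsupp.support_erase]
        have := h3 s hs
        have := Finset.pred_card_le_card_erase (s := s.support) (a := x)
        omega
    · rw [mI_sup]
      have h4 : ∀ s ∈ {s ∈ A | s x = 0}, s.support ⊆ V := by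
        rintro s ⟨hs, h0⟩ j hj
        refine (Finset.mem_insert.1 (h2 s hs hj)).resolve_left ?_
        rintro rfl
        exact (Finsupp.mem_support_iff.1 hj) h0
      have himg : Finsupp.erase x '' {s ∈ A | s x = 0} = {s ∈ A | s x = 0} := by
        have : ∀ s ∈ {s ∈ A | s x = 0}, Finsupp.erase x s = s := fun s hs =>
          Finsupp.erase_of_notMem_support (by simpa using hs.2)
        rw [Set.image_congr this, Set.image_id']
      apply pdQ_quot
      · intro f
        have := mI_colon k {s ∈ A | s x = 0} (fun s hs => h1 s hs.1) x f
        rwa [himg] at this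
      · exact ih e _ (fun s hs => h1 s hs.1) h4 (fun s hs => by have := h3 s hs.1; omega)
end Alg


/-- If `M` is a squarefree monomial ideal in `S = k[x_1,…,x_n]` whose generators all have
total degree greater than `d`, then `S/M` has projective dimension at most `n - d`,
i.e. `S/M` admits a projective resolution of length at most `n - d`. -/
theorem pd_le_of_squarefree_deg_gt
    (k : Type*) [Field k] (n d q : ℕ)
    (m : Fin q → (Fin n →₀ ℕ))
    (hsf : ∀ i j, m i j ≤ 1)
    (hdeg : ∀ i, d < (m i).sum fun _ e => e)
    (M : Ideal (MvPolynomial (Fin n) k))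
    (hM : M = Ideal.span (Set.range fun i => monomial (m i) (1 : k))) :
    ∃ P : CategoryTheory.ProjectiveResolution
        (ModuleCat.of (MvPolynomial (Fin n) k) (MvPolynomial (Fin n) k ⧸ M)),
      ∀ i, n - d < i → Limits.IsZero (P.complex.X i) := by
  have hI : M = mI k (Set.range m) := by
    rw [hM, mI, ← Set.range_comp]; rfl
  have hcard : ∀ i, ((m i).sum fun _ e => e) = (m i).support.card := by
    intro i
    rw [Finsupp.sum, Finset.card_eq_sum_ones]
    refine Finset.sum_congr rfl fun j hj => ?_
    have := hsf i j
    have := Finsupp.mem_support_iff.1 hj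
    omega
  have hpd : PdQ M (n - d + 1) := by
    rw [hI]
    refine pd_main k Finset.univ (n - d) _ ?_ ?_ ?_
    · rintro _ ⟨i, rfl⟩ j; exact hsf i j
    · intro s _; exact Finset.subset_univ _
    · rintro _ ⟨i, rfl⟩
      have h1 := hdeg i
      have h2 := Finset.card_le_univ (m i).support
      rw [hcard] at h1
      simp only [Finset.card_univ, Fintype.card_fin] at h2 ⊢
      omega
  obtain ⟨P, hP⟩ := (PdRes.of_lt _ _ hpd).res
  exact ⟨P, fun i hi => hP i hi⟩
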